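/- (Lemma 3) Let N ≥ 2, let Δ_N be a classical state space with N pure states δ_1, …, δ_N (an (N−1)-simplex: the convex hull of N affinely independent points whose affine hull avoids 0), and let Ω_app be a state space. Suppose that for every family α_1, …, α_N of reversible dynamics on Δ_N there exist a reversible dynamics Λ on Δ_N ⊗_min Ω_app and pure states ξ_1, …, ξ_N of Ω_app such that ξ_n implements α_n through Λ for every n. Then Ω_app has a quasi-classical structure of degree N: there exists an observable {A_k}_{k=1}^N on Ω_app such that A_k(ω) ∈ {0,1} for every pure state ω of Ω_app and A_k(ξ_n) = δ_{kn} for suitable pure states ξ_1, …, ξ_N; equivalently, the pure states of Ω_app admit a quasi-classical decomposition into N nonempty classes. -/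

import Mathlib

open scoped BigOperators

/-- A state space: a compact convex subset `Ω` of a finite-dimensional real vector space `V`
which spans `V` and whose affine hull does not contain the origin. -/
def IsStateSpace {V : Type*} [NormedAddCommGroup V] [NormedSpace ℝ V] (Ω : Set V) : Prop :=
  IsCompact Ω ∧ Convex ℝ Ω ∧ Submodule.span ℝ Ω = ⊤ ∧ (0 : V) ∉ (affineSpan ℝ Ω : Set V)

/-- An effect on `Ω`: a linear functional taking values in `[0,1]` on `Ω`. -/
def IsEffect {V : Type*} [AddCommGroup V] [Module ℝ V] (Ω : Set V) (e : V →ₗ[ℝ] ℝ) : Prop :=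
  ∀ ω ∈ Ω, e ω ∈ Set.Icc (0 : ℝ) 1

/-- The unit effect on `Ω`: the linear functional equal to `1` on `Ω`. -/
def IsUnitEffect {V : Type*} [AddCommGroup V] [Module ℝ V] (Ω : Set V)
    (u : V →ₗ[ℝ] ℝ) : Prop :=
  ∀ ω ∈ Ω, u ω = 1

/-- An observable on `Ω`: a finite family of effects summing to the unit effect. -/
def IsObservable {V : Type*} [AddCommGroup V] [Module ℝ V] (Ω : Set V) {X : Type*} [Fintype X]
    (e : X → (V →ₗ[ℝ] ℝ)) : Prop :=
  (∀ x, IsEffect Ω (e x)) ∧ ∀ ω ∈ Ω, ∑ x, e x ω = 1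

/-- The fidelity of two states `ω, σ ∈ Ω`: the infimum over all observables `{e_x}` on `Ω`
of `∑ x, √(e_x ω) · √(e_x σ)`. -/
noncomputable def fidelity {V : Type*} [AddCommGroup V] [Module ℝ V] (Ω : Set V)
    (ω σ : V) : ℝ :=
  sInf { r | ∃ (nn : ℕ) (e : Fin nn → (V →ₗ[ℝ] ℝ)), IsObservable Ω e ∧
    r = ∑ x, Real.sqrt (e x ω) * Real.sqrt (e x σ) }

/-- The tensor product of two states, realized in the function space indexed by the
product of the index sets. -/
def tmul {ι₁ ι₂ : Type} (ω : ι₁ → ℝ) (σ : ι₂ → ℝ) : ι₁ × ι₂ → ℝ :=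
  fun p => ω p.1 * σ p.2

/-- Auxiliary: partial application of a functional on the second factor. -/
def curryMap {ι₁ ι₂ : Type} (f : (ι₂ → ℝ) →ₗ[ℝ] ℝ) : (ι₁ × ι₂ → ℝ) →ₗ[ℝ] (ι₁ → ℝ) where
  toFun μ := fun i => f (fun j => μ (i, j))
  map_add' μ ν := by funext i; exact f.map_add _ _
  map_smul' c μ := by funext i; exact f.map_smul c _

/-- The tensor product `e ⊗ f` of two effects, as a linear functional on the
composite space; it satisfies `(e ⊗ f)(ω ⊗ σ) = e ω · f σ`. -/
def etmul {ι₁ ι₂ : Type} (e : (ι₁ → ℝ) →ₗ[ℝ] ℝ) (f : (ι₂ → ℝ) →ₗ[ℝ] ℝ) :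
    (ι₁ × ι₂ → ℝ) →ₗ[ℝ] ℝ :=
  e.comp (curryMap f)

/-- The linear map `β ⊗ id` on the composite space. -/
def lTensorId {ι₁ ι₂ : Type} (β : (ι₁ → ℝ) →ₗ[ℝ] (ι₁ → ℝ)) :
    (ι₁ × ι₂ → ℝ) →ₗ[ℝ] (ι₁ × ι₂ → ℝ) where
  toFun μ := fun p => β (fun i => μ (i, p.2)) p.1
  map_add' μ ν := by funext p; exact congrFun (β.map_add _ _) p.1
  map_smul' c μ := by funext p; exact congrFun (β.map_smul c _) p.1

/-- The minimal tensor product of two state spaces: the convex hull of product states. -/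
def minTensor {ι₁ ι₂ : Type} (Ω₁ : Set (ι₁ → ℝ)) (Ω₂ : Set (ι₂ → ℝ)) :
    Set (ι₁ × ι₂ → ℝ) :=
  convexHull ℝ {μ | ∃ ω ∈ Ω₁, ∃ σ ∈ Ω₂, μ = tmul ω σ}

/-- The maximal tensor product of two state spaces: all `μ` normalized by the unit effects
and giving nonnegative probabilities on all product effects. -/
def maxTensor {ι₁ ι₂ : Type} (Ω₁ : Set (ι₁ → ℝ)) (Ω₂ : Set (ι₂ → ℝ)) :
    Set (ι₁ × ι₂ → ℝ) :=
  {μ | (∀ u₁ u₂, IsUnitEffect Ω₁ u₁ → IsUnitEffect Ω₂ u₂ → etmul u₁ u₂ μ = 1) ∧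
    ∀ e f, IsEffect Ω₁ e → IsEffect Ω₂ f → 0 ≤ etmul e f μ}

/-- A composite state space of `Ω₁` and `Ω₂`: a compact convex set between the minimal
and the maximal tensor products. -/
def IsComposite {ι₁ ι₂ : Type} [Fintype ι₁] [Fintype ι₂] (Ω₁ : Set (ι₁ → ℝ))
    (Ω₂ : Set (ι₂ → ℝ)) (Ωtot : Set (ι₁ × ι₂ → ℝ)) : Prop :=
  IsCompact Ωtot ∧ Convex ℝ Ωtot ∧ minTensor Ω₁ Ω₂ ⊆ Ωtot ∧ Ωtot ⊆ maxTensor Ω₁ Ω₂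

/-- A program `ξ ∈ Ω_app` implements the dynamics `α` on `Ω_sys` through the dynamics `Λ`
on the composite: `(e ⊗ u_app)(Λ(ω ⊗ ξ)) = e(α ω)` for all states `ω` and effects `e`. -/
def Implements {ι₁ ι₂ : Type} (Ωsys : Set (ι₁ → ℝ)) (Ωapp : Set (ι₂ → ℝ))
    (Λ : (ι₁ × ι₂ → ℝ) →ₗ[ℝ] (ι₁ × ι₂ → ℝ)) (ξ : ι₂ → ℝ)
    (α : (ι₁ → ℝ) →ₗ[ℝ] (ι₁ → ℝ)) : Prop :=
  ∀ ω ∈ Ωsys, ∀ e : (ι₁ → ℝ) →ₗ[ℝ] ℝ, IsEffect Ωsys e →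
    ∀ u₂ : (ι₂ → ℝ) →ₗ[ℝ] ℝ, IsUnitEffect Ωapp u₂ →
      etmul e u₂ (Λ (tmul ω ξ)) = e (α ω)

/-- If the linear functional `f` is at most `1` on `S`, and the points of `S` where it equals `1`
lie in a convex set `D`, then the same holds on the convex hull of `S`. -/
lemma forall_convexHull_le_one_and_mem {E : Type*} [AddCommGroup E] [Module ℝ E] {S D : Set E}
    (f : E →ₗ[ℝ] ℝ) (hD : Convex ℝ D) (h : ∀ x ∈ S, f x ≤ 1 ∧ (f x = 1 → x ∈ D)) :
    ∀ x ∈ convexHull ℝ S, f x ≤ 1 ∧ (f x = 1 → x ∈ D) := by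
  refine convexHull_min (t := {x | f x ≤ 1 ∧ (f x = 1 → x ∈ D)}) h ?_
  refine convex_iff_forall_pos.2 ?_
  rintro x ⟨hx, hxD⟩ y ⟨hy, hyD⟩ a b ha hb hab
  have hf : f (a • x + b • y) = a * f x + b * f y := by simp
  refine ⟨by rw [hf]; nlinarith, fun h1 => ?_⟩
  rw [hf] at h1
  exact hD (hxD (by nlinarith)) (hyD (by nlinarith)) ha.le hb.le hab

/-- A linear bijection of a convex set onto itself maps extreme points to extreme points. -/
lemma Set.BijOn.map_mem_extremePoints {E : Type*} [AddCommGroup E] [Module ℝ E] {K : Set E}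
    (hK : Convex ℝ K) {L : E →ₗ[ℝ] E} (hL : Set.BijOn L K K) {x : E}
    (hx : x ∈ K.extremePoints ℝ) : L x ∈ K.extremePoints ℝ := by
  refine ⟨hL.mapsTo hx.1, ?_⟩
  intro y hy z hz ⟨a, b, ha, hb, hab, h⟩
  obtain ⟨y', hy', rfl⟩ := hL.surjOn hy
  obtain ⟨z', hz', rfl⟩ := hL.surjOn hz
  have h' : a • y' + b • z' = x :=
    hL.injOn (hK hy' hz' ha.le hb.le hab) hx.1 (by simpa using h)
  rw [hx.2 hy' hz' ⟨a, b, ha, hb, hab, h'⟩]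

lemma IsStateSpace.exists_isUnitEffect {V : Type*} [NormedAddCommGroup V] [NormedSpace ℝ V]
    {Ω : Set V} (hΩ : IsStateSpace Ω) : ∃ u : V →ₗ[ℝ] ℝ, IsUnitEffect Ω u := by
  obtain rfl | ⟨p, hp⟩ := Ω.eq_empty_or_nonempty
  · exact ⟨0, fun _ h => h.elim⟩
  have hpA : p ∈ affineSpan ℝ Ω := subset_affineSpan ℝ Ω hp
  have hpD : p ∉ (affineSpan ℝ Ω).direction := fun h => by
    refine hΩ.2.2.2 ?_
    simpa using AffineSubspace.vadd_mem_of_mem_direction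
      ((affineSpan ℝ Ω).direction.neg_mem h) hpA
  obtain ⟨f, hf, hker⟩ := Submodule.exists_le_ker_of_notMem hpD
  refine ⟨(f p)⁻¹ • f, fun ω hω => ?_⟩
  have h0 : f (ω -ᵥ p) = 0 :=
    hker (AffineSubspace.vsub_mem_direction (subset_affineSpan ℝ Ω hω) hpA)
  have h1 : f ω = f p := by simpa [sub_eq_zero] using h0
  simp [h1, hf]

/-- The vertices of a simplex that is a state space form a basis of the ambient space. -/
lemma exists_basis_of_simplex {V : Type*} [NormedAddCommGroup V] [NormedSpace ℝ V]
    {ι : Type*} {δ : ι → V} (hδ : AffineIndependent ℝ δ)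
    (hΩ : IsStateSpace (convexHull ℝ (Set.range δ))) :
    ∃ b : Module.Basis ι ℝ V, ∀ i, b i = δ i := by
  obtain ⟨u, hu⟩ := hΩ.exists_isUnitEffect
  have huδ : ∀ i, u (δ i) = 1 := fun i => hu _ (subset_convexHull ℝ _ ⟨i, rfl⟩)
  have hli : LinearIndependent ℝ δ := by
    rw [linearIndependent_iff']
    intro s g hg
    refine affineIndependent_iff.1 hδ s g ?_ hg
    simpa [huδ] using congrArg u hg
  refine ⟨Module.Basis.mk hli ?_, Module.Basis.mk_apply hli _⟩
  rw [← hΩ.2.2.1, Submodule.span_le]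
  exact convexHull_min Submodule.subset_span (Submodule.span ℝ (Set.range δ)).convex

lemma Module.Basis.isObservable_coord {V : Type*} [AddCommGroup V] [Module ℝ V]
    {ι : Type*} [Fintype ι] (b : Module.Basis ι ℝ V) :
    IsObservable (convexHull ℝ (Set.range b)) b.coord := by
  classical
  constructor
  · intro i
    refine convexHull_min (t := b.coord i ⁻¹' Set.Icc 0 1) ?_
      ((convex_Icc 0 1).linear_preimage _)
    rintro _ ⟨j, rfl⟩
    rw [Set.mem_preimage, b.coord_apply, b.repr_self, Finsupp.single_apply]
    split_ifs <;> simp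
  · have : convexHull ℝ (Set.range b) ⊆ (∑ i, b.coord i : V →ₗ[ℝ] ℝ) ⁻¹' {1} := by
      refine convexHull_min ?_ ((convex_singleton _).linear_preimage _)
      rintro _ ⟨j, rfl⟩
      simp [Finsupp.single_apply]
    intro ω hω
    simpa using this hω

lemma Module.Basis.bijOn_equiv_convexHull {V : Type*} [AddCommGroup V] [Module ℝ V]
    {ι : Type*} (b : Module.Basis ι ℝ V) (σ : Equiv.Perm ι) :
    Set.BijOn (b.equiv b σ).toLinearMap (convexHull ℝ (Set.range b))
      (convexHull ℝ (Set.range b)) := by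
  have himg : (b.equiv b σ).toLinearMap '' convexHull ℝ (Set.range b) =
      convexHull ℝ (Set.range b) := by
    rw [LinearMap.image_convexHull, ← Set.range_comp]
    congr 1
    rw [← σ.surjective.range_comp b]
    congr 1
    funext i
    simp
  rw [Set.BijOn, Set.SurjOn, himg]
  exact ⟨Set.mapsTo_iff_image_subset.2 himg.subset, (b.equiv b σ).injective.injOn, subset_rfl⟩

section

variable {ι₁ ι₂ : Type}

/-- Tensoring with a fixed left factor, as a linear map. -/
def tmulLeft (ω : ι₁ → ℝ) : (ι₂ → ℝ) →ₗ[ℝ] (ι₁ × ι₂ → ℝ) where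
  toFun σ := tmul ω σ
  map_add' σ τ := by funext p; simp [tmul, mul_add]
  map_smul' c σ := by funext p; simp [tmul, mul_left_comm]

@[simp] lemma tmulLeft_apply (ω : ι₁ → ℝ) (σ : ι₂ → ℝ) : tmulLeft ω σ = tmul ω σ := rfl

lemma tmul_right_injective {ω : ι₁ → ℝ} (hω : ω ≠ 0) :
    Function.Injective (tmul ω : (ι₂ → ℝ) → ι₁ × ι₂ → ℝ) := by
  obtain ⟨i, hi⟩ := Function.ne_iff.1 hω
  intro σ τ h
  funext j
  exact mul_left_cancel₀ hi (congrFun h (i, j))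

lemma curryMap_tmul (f : (ι₂ → ℝ) →ₗ[ℝ] ℝ) (ω : ι₁ → ℝ) (σ : ι₂ → ℝ) :
    curryMap f (tmul ω σ) = f σ • ω := by
  funext i
  have : (fun j => tmul ω σ (i, j)) = ω i • σ := rfl
  simp [curryMap, this, mul_comm]

lemma etmul_tmul (e : (ι₁ → ℝ) →ₗ[ℝ] ℝ) (f : (ι₂ → ℝ) →ₗ[ℝ] ℝ) (ω : ι₁ → ℝ) (σ : ι₂ → ℝ) :
    etmul e f (tmul ω σ) = e ω * f σ := by
  simp [etmul, curryMap_tmul, mul_comm]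

lemma tmul_mem_minTensor {Ω₁ : Set (ι₁ → ℝ)} {Ω₂ : Set (ι₂ → ℝ)} {ω : ι₁ → ℝ} {σ : ι₂ → ℝ}
    (hω : ω ∈ Ω₁) (hσ : σ ∈ Ω₂) : tmul ω σ ∈ minTensor Ω₁ Ω₂ :=
  subset_convexHull ℝ _ ⟨ω, hω, σ, hσ, rfl⟩

/-- Discarding the second factor of a state of the minimal tensor product gives a state. -/
lemma curryMap_mem_of_mem_minTensor {Ω₁ : Set (ι₁ → ℝ)} {Ω₂ : Set (ι₂ → ℝ)}
    (h₁ : Convex ℝ Ω₁) {u : (ι₂ → ℝ) →ₗ[ℝ] ℝ} (hu : IsUnitEffect Ω₂ u) {μ : ι₁ × ι₂ → ℝ}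
    (hμ : μ ∈ minTensor Ω₁ Ω₂) : curryMap u μ ∈ Ω₁ := by
  refine convexHull_min (t := curryMap u ⁻¹' Ω₁) ?_ (h₁.linear_preimage _) hμ
  rintro _ ⟨ω, hω, σ, hσ, rfl⟩
  simpa [curryMap_tmul, hu σ hσ] using hω

/-- A pure state of the minimal tensor product is a product whose first factor is pure. -/
lemma exists_eq_tmul_of_mem_extremePoints_minTensor {Ω₁ : Set (ι₁ → ℝ)} {Ω₂ : Set (ι₂ → ℝ)}
    {u : (ι₂ → ℝ) →ₗ[ℝ] ℝ} (hu : IsUnitEffect Ω₂ u) {μ : ι₁ × ι₂ → ℝ}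
    (hμ : μ ∈ (minTensor Ω₁ Ω₂).extremePoints ℝ) :
    ∃ ω ∈ Ω₁.extremePoints ℝ, ∃ σ ∈ Ω₂, μ = tmul ω σ := by
  obtain ⟨ω, hω, σ, hσ, rfl⟩ := extremePoints_convexHull_subset hμ
  refine ⟨ω, ⟨hω, ?_⟩, σ, hσ, rfl⟩
  rintro x hx y hy ⟨a, b, ha, hb, hab, h⟩
  have hxy : a • tmul x σ + b • tmul y σ = tmul ω σ := by
    funext p
    simp [tmul, ← h]
    ring
  have key := hμ.2 (tmul_mem_minTensor hx hσ) (tmul_mem_minTensor hy hσ)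
    ⟨a, b, ha, hb, hab, hxy⟩
  simpa [curryMap_tmul, hu σ hσ] using congrArg (curryMap u) key

/-- The product of a vertex of a simplex and a pure state is pure in the minimal tensor product. -/
lemma tmul_basis_mem_extremePoints_minTensor {ι : Type*} [Fintype ι]
    (b : Module.Basis ι ℝ (ι₁ → ℝ)) (i : ι) {Ω₂ : Set (ι₂ → ℝ)} (h₂ : Convex ℝ Ω₂)
    {u : (ι₂ → ℝ) →ₗ[ℝ] ℝ} (hu : IsUnitEffect Ω₂ u) {σ : ι₂ → ℝ}
    (hσ : σ ∈ Ω₂.extremePoints ℝ) :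
    tmul (b i) σ ∈ (minTensor (convexHull ℝ (Set.range b)) Ω₂).extremePoints ℝ := by
  have hvertex : ∀ ω ∈ convexHull ℝ (Set.range b),
      b.coord i ω ≤ 1 ∧ (b.coord i ω = 1 → ω ∈ ({b i} : Set (ι₁ → ℝ))) := by
    classical
    refine forall_convexHull_le_one_and_mem _ (convex_singleton _) ?_
    rintro _ ⟨j, rfl⟩
    rw [b.coord_apply, b.repr_self, Finsupp.single_apply]
    split_ifs with hji <;> simp [hji]
  have hface : ∀ μ ∈ minTensor (convexHull ℝ (Set.range b)) Ω₂,
      etmul (b.coord i) u μ ≤ 1 ∧ (etmul (b.coord i) u μ = 1 → μ ∈ tmulLeft (b i) '' Ω₂) := by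
    refine forall_convexHull_le_one_and_mem _ (h₂.linear_image _) ?_
    rintro _ ⟨ω, hω, τ, hτ, rfl⟩
    rw [etmul_tmul, hu τ hτ, mul_one]
    refine ⟨(hvertex ω hω).1, fun h => ⟨τ, hτ, ?_⟩⟩
    rw [(hvertex ω hω).2 h, tmulLeft_apply]
  refine ⟨tmul_mem_minTensor (subset_convexHull ℝ _ ⟨i, rfl⟩) hσ.1, ?_⟩
  rintro x hx y hy ⟨s, t, hs, ht, hst, h⟩
  have h1 := congrArg (etmul (b.coord i) u) h
  rw [etmul_tmul, hu σ hσ.1, map_add, map_smul, map_smul, smul_eq_mul, smul_eq_mul,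
    b.coord_apply, b.repr_self, Finsupp.single_eq_same, mul_one] at h1
  have hx1 := (hface x hx).1
  have hy1 := (hface y hy).1
  obtain ⟨τ, hτ, rfl⟩ := (hface x hx).2 (by nlinarith)
  obtain ⟨ρ, hρ, rfl⟩ := (hface y hy).2 (by nlinarith)
  have hσ' : s • τ + t • ρ = σ := tmul_right_injective (b.ne_zero i) (by
    rw [← tmulLeft_apply, map_add, map_smul, map_smul, h])
  rw [tmulLeft_apply, hσ.2 hτ hρ ⟨s, t, hs, ht, hst, hσ'⟩]

end

/-- Lemma 3: if an apparatus can program (through some reversible dynamics of the minimal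
tensor product with pure programs) every family of `N` reversible dynamics of a classical
system with `N` pure states, then the apparatus has a quasi-classical structure of
degree `N`. -/
theorem universal_programming_implies_qc {ι₁ ι₂ : Type} [Fintype ι₁] [Fintype ι₂]
    (N : ℕ) (hN : 2 ≤ N)
    (δ : Fin N → (ι₁ → ℝ)) (hδ : AffineIndependent ℝ δ)
    (Ωsys : Set (ι₁ → ℝ)) (hΩsys : Ωsys = convexHull ℝ (Set.range δ))
    (hsys : IsStateSpace Ωsys)
    (Ωapp : Set (ι₂ → ℝ)) (happ : IsStateSpace Ωapp)
    (hprog : ∀ α : Fin N → ((ι₁ → ℝ) →ₗ[ℝ] (ι₁ → ℝ)), (∀ n, Set.BijOn (α n) Ωsys Ωsys) →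
      ∃ (Λ : (ι₁ × ι₂ → ℝ) →ₗ[ℝ] (ι₁ × ι₂ → ℝ)) (ξ : Fin N → (ι₂ → ℝ)),
        Set.BijOn Λ (minTensor Ωsys Ωapp) (minTensor Ωsys Ωapp) ∧
        (∀ n, ξ n ∈ Ωapp.extremePoints ℝ) ∧
        ∀ n, Implements Ωsys Ωapp Λ (ξ n) (α n)) :
    ∃ A : Fin N → ((ι₂ → ℝ) →ₗ[ℝ] ℝ), IsObservable Ωapp A ∧
      (∀ k, ∀ ω ∈ Ωapp.extremePoints ℝ, A k ω = 0 ∨ A k ω = 1) ∧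
      ∃ ξ : Fin N → (ι₂ → ℝ), (∀ n, ξ n ∈ Ωapp.extremePoints ℝ) ∧
        ∀ k n : Fin N, A k (ξ n) = if k = n then 1 else 0 := by
  subst hΩsys
  obtain ⟨b, hb⟩ := exists_basis_of_simplex hδ hsys
  obtain rfl : ⇑b = δ := funext hb
  obtain ⟨u, hu⟩ := happ.exists_isUnitEffect
  let o : Fin N := ⟨0, by omega⟩
  obtain ⟨Λ, ξ, hΛ, hξ, himp⟩ := hprog
    (fun n => (b.equiv b (Equiv.swap o n)).toLinearMap) (fun n => b.bijOn_equiv_convexHull _)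
  have hbo : b o ∈ convexHull ℝ (Set.range b) := subset_convexHull ℝ _ ⟨o, rfl⟩
  obtain ⟨hcoord, hsum⟩ := b.isObservable_coord
  have hstate : ∀ σ ∈ Ωapp,
      curryMap u (Λ (tmul (b o) σ)) ∈ convexHull ℝ (Set.range b) := fun σ hσ =>
    curryMap_mem_of_mem_minTensor (convex_convexHull ℝ _) hu
      (hΛ.mapsTo (tmul_mem_minTensor hbo hσ))
  refine ⟨fun k => (etmul (b.coord k) u).comp (Λ.comp (tmulLeft (b o))),
    ⟨fun k σ hσ => hcoord k _ (hstate σ hσ), fun σ hσ => hsum _ (hstate σ hσ)⟩, ?_,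
    ξ, hξ, fun k n => ?_⟩
  · intro k σ hσ
    have hpure := hΛ.map_mem_extremePoints (convex_convexHull ℝ _)
      (tmul_basis_mem_extremePoints_minTensor b o happ.2.1 hu hσ)
    obtain ⟨ω, hω, τ, hτ, h⟩ := exists_eq_tmul_of_mem_extremePoints_minTensor hu hpure
    obtain ⟨j, rfl⟩ := extremePoints_convexHull_subset hω
    rw [LinearMap.comp_apply, LinearMap.comp_apply, tmulLeft_apply, h, etmul_tmul, hu τ hτ,
      mul_one, b.coord_apply, b.repr_self, Finsupp.single_apply]
    split_ifs <;> simp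
  · rw [LinearMap.comp_apply, LinearMap.comp_apply, tmulLeft_apply,
      himp n _ hbo _ (hcoord k) u hu]
    simp [Finsupp.single_apply, eq_comm]
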